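/- arXiv:1607.05830 — 2 statements merged into one kernel-verified Lean document; each statement's English description precedes it below -/
import Mathlib

section
/- Parallel composition of probability measures is Scott-continuous in each argument: for probability measures on (Set H, 𝔅), if μ₁ ⊑ μ₂ then μ₁ & ν ⊑ μ₂ & ν (and symmetrically ν & μ₁ ⊑ ν & μ₂); and if D is a nonempty ⊑-directed family with ⊑-supremum μ*, then μ* & ν is the ⊑-supremum of { μ & ν : μ ∈ D }, i.e. (μ* & ν)(U) = ⨆_{μ ∈ D} (μ & ν)(U) for every Scott-open U. -/
open MeasureTheory Set ENNReal

/-- A set of subsets of `H` is Scott-open if it is an upper set for inclusion and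
meets every directed family of subsets whose union it contains. -/
def ScottOpen {H : Type*} (U : Set (Set H)) : Prop :=
  (∀ ⦃a b : Set H⦄, a ⊆ b → a ∈ U → b ∈ U) ∧
  ∀ D : Set (Set H), D.Nonempty → DirectedOn (· ⊆ ·) D → ⋃₀ D ∈ U → (D ∩ U).Nonempty

/-- The Borel σ-algebra on `Set H` generated by the Scott-open sets. -/
def scottBorel (H : Type*) : MeasurableSpace (Set H) :=
  MeasurableSpace.generateFrom {U : Set (Set H) | ScottOpen U}

/-- The order `μ ⊑ ν` on measures: `μ U ≤ ν U` for every Scott-open `U`. -/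
def MeasLE {H : Type*} (μ ν : @Measure (Set H) (scottBorel H)) : Prop :=
  ∀ U : Set (Set H), ScottOpen U → μ U ≤ ν U

/-- Parallel composition `μ & ν`: the pushforward of the product measure `μ × ν`
under the union map `(a, b) ↦ a ∪ b`. -/
noncomputable def parComp {H : Type*} (μ ν : @Measure (Set H) (scottBorel H)) :
    @Measure (Set H) (scottBorel H) :=
  @Measure.map (Set H × Set H) (Set H)
    (@Prod.instMeasurableSpace _ _ (scottBorel H) (scottBorel H)) (scottBorel H)
    (fun p => p.1 ∪ p.2)
    (@Measure.prod (Set H) (Set H) (scottBorel H) (scottBorel H) μ ν)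

section

variable {H : Type*}

attribute [local instance] scottBorel

lemma ScottOpen.measurableSet {U : Set (Set H)} (hU : ScottOpen U) : MeasurableSet U :=
  MeasurableSpace.measurableSet_generateFrom hU

lemma ScottOpen.exists_finset_subset {U : Set (Set H)} (hU : ScottOpen U) {a : Set H}
    (ha : a ∈ U) : ∃ b : Finset H, (b : Set H) ∈ U ∧ (b : Set H) ⊆ a := by
  classical
  obtain ⟨_, ⟨b, hb, rfl⟩, hbU⟩ := hU.2 ((fun b : Finset H => (b : Set H)) '' {b | (b : Set H) ⊆ a})
    ⟨_, ∅, by simp, rfl⟩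
    (by
      rintro _ ⟨b, hb, rfl⟩ _ ⟨c, hc, rfl⟩
      exact ⟨_, ⟨b ∪ c, by simpa using ⟨hb, hc⟩, rfl⟩, by simp, by simp⟩)
    (by
      refine hU.1 (fun x hx => ?_) ha
      exact ⟨_, ⟨{x}, by simpa using hx, rfl⟩, by simp⟩)
  exact ⟨b, hbU, hb⟩

/-- The finite union of the basic Scott-open sets `{a | b ⊆ a}` for `b ∈ F`. -/
def finsetUpper (F : Finset (Finset H)) : Set (Set H) :=
  {a | ∃ b ∈ F, (b : Set H) ⊆ a}

lemma scottOpen_finsetUpper (F : Finset (Finset H)) : ScottOpen (finsetUpper F) := by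
  refine ⟨fun a b hab ⟨c, hc, hca⟩ => ⟨c, hc, hca.trans hab⟩, ?_⟩
  rintro D hD hdir ⟨b, hb, hbD⟩
  obtain ⟨t, ht, hbt⟩ :=
    DirectedOn.exists_mem_subset_of_finset_subset_biUnion (f := id) hD hdir
      (by simpa [sUnion_eq_biUnion] using hbD)
  exact ⟨t, ht, b, hb, hbt⟩

lemma ScottOpen.preimage_union_right {U : Set (Set H)} (hU : ScottOpen U) (b : Set H) :
    ScottOpen {a | a ∪ b ∈ U} := by
  refine ⟨fun a c hac ha => hU.1 (union_subset_union_left b hac) ha, fun D hD hdir hDU => ?_⟩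
  obtain ⟨_, ⟨a, ha, rfl⟩, haU⟩ := hU.2 ((· ∪ b) '' D) (hD.image _)
    (by
      rintro _ ⟨a, ha, rfl⟩ _ ⟨c, hc, rfl⟩
      obtain ⟨d, hd, had, hcd⟩ := hdir a ha c hc
      exact ⟨_, ⟨d, hd, rfl⟩, union_subset_union_left b had, union_subset_union_left b hcd⟩)
    (by
      refine hU.1 ?_ hDU
      obtain ⟨d, hd⟩ := hD
      rintro x (⟨a, ha, hxa⟩ | hxb)
      · exact ⟨_, ⟨a, ha, rfl⟩, Or.inl hxa⟩
      · exact ⟨_, ⟨d, hd, rfl⟩, Or.inr hxb⟩)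
  exact ⟨a, ha, haU⟩

lemma ScottOpen.measure_eq_iSup_finsetUpper [Countable H] {U : Set (Set H)} (hU : ScottOpen U)
    (μ : Measure (Set H)) :
    μ U = ⨆ F : {F : Finset (Finset H) // finsetUpper F ⊆ U}, μ (finsetUpper F.1) := by
  classical
  have hUn : U = ⋃ F : {F : Finset (Finset H) // finsetUpper F ⊆ U}, finsetUpper F.1 := by
    refine Subset.antisymm (fun a ha => ?_) (iUnion_subset fun F => F.2)
    obtain ⟨b, hbU, hba⟩ := hU.exists_finset_subset ha
    refine mem_iUnion.2 ⟨⟨{b}, ?_⟩, b, by simp, hba⟩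
    rintro c ⟨d, hd, hdc⟩
    obtain rfl := Finset.mem_singleton.1 hd
    exact hU.1 hdc hbU
  have hdir : Directed (· ⊆ ·)
      fun F : {F : Finset (Finset H) // finsetUpper F ⊆ U} => finsetUpper F.1 := by
    rintro ⟨F, hF⟩ ⟨G, hG⟩
    refine ⟨⟨F ∪ G, ?_⟩, ?_, ?_⟩
    · rintro a ⟨b, hb, hba⟩
      rcases Finset.mem_union.1 hb with hb | hb
      exacts [hF ⟨b, hb, hba⟩, hG ⟨b, hb, hba⟩]
    · rintro a ⟨b, hb, hba⟩
      exact ⟨b, Finset.mem_union_left _ hb, hba⟩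
    · rintro a ⟨b, hb, hba⟩
      exact ⟨b, Finset.mem_union_right _ hb, hba⟩
  conv_lhs => rw [hUn]
  exact hdir.measure_iUnion

lemma measurable_union_scottBorel [Countable H] :
    Measurable fun p : Set H × Set H => p.1 ∪ p.2 := by
  classical
  refine measurable_generateFrom fun U hU => ?_
  have hEq : (fun p : Set H × Set H => p.1 ∪ p.2) ⁻¹' U =
      ⋃ q : {q : Finset H × Finset H // (q.1 ∪ q.2 : Set H) ∈ U},
        finsetUpper {q.1.1} ×ˢ finsetUpper {q.1.2} := by
    ext ⟨a, c⟩
    simp only [mem_preimage, mem_iUnion, mem_prod]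
    constructor
    · intro h
      obtain ⟨b, hbU, hb⟩ := hU.exists_finset_subset h
      refine ⟨⟨(b.filter (· ∈ a), b.filter (· ∈ c)), ?_⟩, ?_, ?_⟩
      · refine hU.1 (fun x hx => ?_) hbU
        rcases hb hx with h | h
        · exact Or.inl (by simpa using ⟨hx, h⟩)
        · exact Or.inr (by simpa using ⟨hx, h⟩)
      · exact ⟨_, Finset.mem_singleton_self _, fun x hx => by simp_all⟩
      · exact ⟨_, Finset.mem_singleton_self _, fun x hx => by simp_all⟩
    · rintro ⟨⟨⟨b, d⟩, hq⟩, ⟨_, hb, hba⟩, ⟨_, hd, hdc⟩⟩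
      obtain rfl := Finset.mem_singleton.1 hb
      obtain rfl := Finset.mem_singleton.1 hd
      exact hU.1 (union_subset_union hba hdc) hq
  rw [hEq]
  exact MeasurableSet.iUnion fun q =>
    (scottOpen_finsetUpper _).measurableSet.prod (scottOpen_finsetUpper _).measurableSet

lemma parComp_apply [Countable H] (μ ν : Measure (Set H)) [SFinite μ] [SFinite ν]
    {U : Set (Set H)} (hU : ScottOpen U) :
    parComp μ ν U = ∫⁻ b, μ {a | a ∪ b ∈ U} ∂ν := by
  rw [parComp, Measure.map_apply measurable_union_scottBorel hU.measurableSet,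
    Measure.prod_apply_symm (measurable_union_scottBorel hU.measurableSet)]
  rfl

lemma parComp_comm [Countable H] (μ ν : Measure (Set H)) [SFinite μ] [SFinite ν] :
    parComp μ ν = parComp ν μ := by
  rw [parComp, parComp, ← Measure.prod_swap,
    Measure.map_map measurable_union_scottBorel measurable_swap]
  simp only [Function.comp_def, Prod.fst_swap, Prod.snd_swap, union_comm]

lemma MeasLE.parComp_right [Countable H] {μ₁ μ₂ : Measure (Set H)} (h : MeasLE μ₁ μ₂)
    (ν : Measure (Set H)) [SFinite μ₁] [SFinite μ₂] [SFinite ν] :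
    MeasLE (parComp μ₁ ν) (parComp μ₂ ν) := by
  intro U hU
  rw [parComp_apply _ _ hU, parComp_apply _ _ hU]
  exact lintegral_mono fun b => h _ (hU.preimage_union_right b)

/-- A directed supremum of measures over Scott-open sets is attained along a sequence. -/
lemma exists_seq_measLE_iSup [Countable H] {D : Set (Measure (Set H))} {μstar : Measure (Set H)}
    (hD : D.Nonempty) (hdir : DirectedOn MeasLE D)
    (hsup : ∀ U : Set (Set H), ScottOpen U → μstar U = ⨆ μ ∈ D, μ U) :
    ∃ g : ℕ → Measure (Set H), (∀ n, g n ∈ D) ∧ (∀ n, MeasLE (g n) (g (n + 1))) ∧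
      ∀ U : Set (Set H), ScottOpen U → μstar U = ⨆ n, g n U := by
  have hseq : ∀ F : Finset (Finset H), ∃ u : ℕ → D,
      μstar (finsetUpper F) = ⨆ n, (u n).1 (finsetUpper F) := by
    intro F
    obtain ⟨v, hv, hlim, hmem⟩ := exists_seq_tendsto_sSup
      (hD.image fun μ : Measure (Set H) => μ (finsetUpper F)) (OrderTop.bddAbove _)
    choose u huD hu using hmem
    refine ⟨fun n => ⟨u n, huD n⟩, ?_⟩
    rw [hsup _ (scottOpen_finsetUpper F), ← sSup_image]
    simp only [hu]
    exact tendsto_nhds_unique hlim (tendsto_atTop_iSup hv)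
  choose u hu using hseq
  obtain ⟨e, he⟩ := exists_surjective_nat (Finset (Finset H) × ℕ)
  choose k hkD hk₁ hk₂ using hdir
  let g : ℕ → D := fun n => Nat.rec ⟨hD.some, hD.some_mem⟩
    (fun n p => ⟨k p.1 p.2 (u (e n).1 (e n).2).1 (u (e n).1 (e n).2).2, hkD _ _ _ _⟩) n
  refine ⟨fun n => (g n).1, fun n => (g n).2, fun n => hk₁ _ _ _ _, fun U hU => ?_⟩
  refine le_antisymm ?_ (iSup_le fun n => ?_)
  · rw [hU.measure_eq_iSup_finsetUpper μstar]
    refine iSup_le fun ⟨F, hF⟩ => ?_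
    rw [hu F]
    refine iSup_le fun n => ?_
    obtain ⟨m, hm⟩ := he (F, n)
    have hle : MeasLE (u (e m).1 (e m).2).1 (g (m + 1)).1 := hk₂ _ _ _ _
    rw [hm] at hle
    exact (hle _ (scottOpen_finsetUpper F)).trans
      ((measure_mono hF).trans (le_iSup (fun n => (g n).1 U) (m + 1)))
  · rw [hsup U hU]
    exact le_iSup₂ (f := fun (μ : Measure (Set H)) (_ : μ ∈ D) => μ U) (g n).1 (g n).2

end

/-- Parallel composition of probability measures is Scott-continuous in each argument:
monotone with respect to `⊑` in each argument, and preserving `⊑`-suprema of nonempty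
`⊑`-directed families in the first argument. -/
theorem parComp_scottCont {H : Type*} [Countable H]
    (ν : @Measure (Set H) (scottBorel H))
    (hν : @IsProbabilityMeasure (Set H) (scottBorel H) ν) :
    (∀ μ₁ μ₂ : @Measure (Set H) (scottBorel H),
      @IsProbabilityMeasure (Set H) (scottBorel H) μ₁ →
      @IsProbabilityMeasure (Set H) (scottBorel H) μ₂ →
      MeasLE μ₁ μ₂ → MeasLE (parComp μ₁ ν) (parComp μ₂ ν) ∧
        MeasLE (parComp ν μ₁) (parComp ν μ₂)) ∧
    (∀ (D : Set (@Measure (Set H) (scottBorel H)))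
        (μstar : @Measure (Set H) (scottBorel H)),
      D.Nonempty → (∀ μ ∈ D, @IsProbabilityMeasure (Set H) (scottBorel H) μ) →
      DirectedOn MeasLE D →
      @IsProbabilityMeasure (Set H) (scottBorel H) μstar →
      (∀ U : Set (Set H), ScottOpen U → μstar U = ⨆ μ ∈ D, μ U) →
      ∀ U : Set (Set H), ScottOpen U →
        (parComp μstar ν) U = ⨆ μ ∈ D, (parComp μ ν) U) := by
  let _ : MeasurableSpace (Set H) := scottBorel H
  refine ⟨fun μ₁ μ₂ _ _ h => ?_, fun D μstar hD hprob hdir _ hsup U hU => le_antisymm ?_ ?_⟩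
  · rw [parComp_comm ν μ₁, parComp_comm ν μ₂]
    exact ⟨h.parComp_right ν, h.parComp_right ν⟩
  · obtain ⟨g, hgD, hg, hgsup⟩ := exists_seq_measLE_iSup hD hdir hsup
    have hgprob : ∀ n, IsProbabilityMeasure (g n) := fun n => hprob _ (hgD n)
    rw [parComp_apply _ _ hU]
    simp only [fun b => hgsup _ (hU.preimage_union_right b)]
    rw [lintegral_iSup (f := fun n b => g n {a | a ∪ b ∈ U})
      (fun n => measurable_measure_prodMk_right
        (measurable_union_scottBorel hU.measurableSet))
      (monotone_nat_of_le_succ fun n b => hg n _ (hU.preimage_union_right b))]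
    refine iSup_le fun n => ?_
    rw [← parComp_apply _ _ hU]
    exact le_iSup₂ (f := fun (μ : Measure (Set H)) (_ : μ ∈ D) => parComp μ ν U) (g n) (hgD n)
  · refine iSup₂_le fun μ hμ => ?_
    have := hprob μ hμ
    have hle : MeasLE μ μstar := fun V hV => by
      rw [hsup V hV]
      exact le_iSup₂ (f := fun (μ : Measure (Set H)) (_ : μ ∈ D) => μ V) μ hμ
    exact hle.parComp_right ν U hU
end

section
/- Let D be a nonempty ⊑-directed family of probability measures on (Set H, 𝔅) with ⊑-supremum μ*, and let f : Set H → ℝ be continuous for the Cantor topology with values in [0,1] (such an f is Borel measurable, since the Cantor and Scott topologies generate the same σ-algebra 𝔅). Then the integrals of f converge along the directed family to the integral against the supremum: for every ε > 0 there exists μ ∈ D such that for all ν ∈ D with μ ⊑ ν, |∫ f dν − ∫ f dμ*| < ε. -/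
open MeasureTheory Set ENNReal

/-- The Cantor topology on `Set H`: generated by the sets `B_{h} = {c | h ∈ c}` and
their complements. -/
def cantorTop (H : Type*) : TopologicalSpace (Set H) :=
  TopologicalSpace.generateFrom
    ({U | ∃ h : H, U = {c : Set H | h ∈ c}} ∪ {U | ∃ h : H, U = {c : Set H | h ∉ c}})

open Filter Topology

/-- The integrals of a real function along a filter of measures converge to its integral against
`μ₀`, provided that they do so for functions uniformly approximating it. -/
theorem tendsto_integral_of_forall_exists_approx {X : Type*} [MeasurableSpace X]
    {F : Filter (Measure X)} {μ₀ : Measure X} [IsProbabilityMeasure μ₀]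
    (hF : ∀ᶠ ν in F, IsProbabilityMeasure ν) {f : X → ℝ}
    (hf : ∀ ν : Measure X, IsProbabilityMeasure ν → Integrable f ν)
    (happrox : ∀ δ > 0, ∃ g : X → ℝ, (∀ ν : Measure X, IsProbabilityMeasure ν → Integrable g ν) ∧
      (∀ x, ‖f x - g x‖ ≤ δ) ∧ Tendsto (fun ν => ∫ x, g x ∂ν) F (𝓝 (∫ x, g x ∂μ₀))) :
    Tendsto (fun ν => ∫ x, f x ∂ν) F (𝓝 (∫ x, f x ∂μ₀)) := by
  rw [Metric.tendsto_nhds]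
  intro ε hε
  obtain ⟨g, hg, hfg, hlim⟩ := happrox (ε / 4) (by positivity)
  have key : ∀ ν : Measure X, IsProbabilityMeasure ν →
      |∫ x, f x ∂ν - ∫ x, g x ∂ν| ≤ ε / 4 := by
    intro ν hν
    rw [← integral_sub (hf ν hν) (hg ν hν)]
    simpa using norm_integral_le_of_norm_le_const (μ := ν) (ae_of_all _ hfg)
  filter_upwards [hF, Metric.tendsto_nhds.1 hlim (ε / 4) (by positivity)] with ν hν hdist
  rw [Real.dist_eq] at hdist ⊢
  have h₁ := abs_le.1 (key ν hν)
  have h₂ := abs_le.1 (key μ₀ inferInstance)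
  have h₃ := abs_lt.1 hdist
  rw [abs_lt]
  constructor <;> linarith [h₁.1, h₁.2, h₂.1, h₂.2, h₃.1, h₃.2]

/-- On a compact space, a class of measurable clopen sets which is closed under finite
intersections and separates points is convergence-determining for probability measures. Moreover
continuous functions are measurable. -/
theorem measurable_and_tendsto_integral_of_separating {X : Type*} [TopologicalSpace X]
    [CompactSpace X] [MeasurableSpace X] {F : Filter (Measure X)} {μ₀ : Measure X}
    [IsProbabilityMeasure μ₀] (hF : ∀ᶠ ν in F, IsProbabilityMeasure ν) {S : Set (Set X)}
    (hclopen : ∀ U ∈ S, IsClopen U) (hmeas : ∀ U ∈ S, MeasurableSet U) (huniv : univ ∈ S)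
    (hinter : ∀ U ∈ S, ∀ V ∈ S, U ∩ V ∈ S)
    (hsep : ∀ x y, x ≠ y → ∃ U ∈ S, ¬(x ∈ U ↔ y ∈ U))
    (hlim : ∀ U ∈ S, Tendsto (fun ν => ν U) F (𝓝 (μ₀ U))) (f : C(X, ℝ)) :
    Measurable f ∧ Tendsto (fun ν => ∫ x, f x ∂ν) F (𝓝 (∫ x, f x ∂μ₀)) := by
  let M : Submonoid C(X, ℝ) :=
    { carrier := {g | ∃ U ∈ S, ⇑g = U.indicator 1}
      one_mem' := ⟨univ, huniv, by simp⟩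
      mul_mem' := by
        rintro g k ⟨U, hU, hg⟩ ⟨V, hV, hk⟩
        exact ⟨U ∩ V, hinter U hU V hV, by
          rw [ContinuousMap.coe_mul, hg, hk, Set.inter_indicator_one]⟩ }
  let A : Subalgebra ℝ C(X, ℝ) := Algebra.adjoin ℝ M
  have hint : ∀ g : C(X, ℝ), Measurable g →
      ∀ ν : Measure X, IsProbabilityMeasure ν → Integrable g ν := fun g hg ν _ =>
    Integrable.of_bound hg.aestronglyMeasurable ‖g‖ (ae_of_all _ g.norm_coe_le_norm)
  have hA : ∀ g ∈ A, Measurable g ∧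
      Tendsto (fun ν => ∫ x, g x ∂ν) F (𝓝 (∫ x, g x ∂μ₀)) := by
    intro g hg
    replace hg : g ∈ Submodule.span ℝ (M : Set C(X, ℝ)) := by
      have := (Subalgebra.mem_toSubmodule A).2 hg
      rwa [show A = Algebra.adjoin ℝ (M : Set C(X, ℝ)) from rfl, Algebra.adjoin_eq_span,
        Submonoid.closure_eq] at this
    induction hg using Submodule.span_induction with
    | mem g hg =>
      obtain ⟨U, hU, hgU⟩ := hg
      have hUm := hmeas U hU
      simp only [hgU, integral_indicator_one hUm]
      refine ⟨measurable_one.indicator hUm, ?_⟩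
      exact (ENNReal.tendsto_toReal (measure_ne_top μ₀ U)).comp (hlim U hU)
    | zero => exact ⟨measurable_zero, by simpa using tendsto_const_nhds⟩
    | add g k _ _ hg hk =>
      refine ⟨by simpa using hg.1.add hk.1, ?_⟩
      have hadd : ∀ ν : Measure X, IsProbabilityMeasure ν →
          ∫ x, (g + k) x ∂ν = ∫ x, g x ∂ν + ∫ x, k x ∂ν := fun ν hν =>
        integral_add (hint g hg.1 ν hν) (hint k hk.1 ν hν)
      rw [hadd μ₀ inferInstance]
      refine (hg.2.add hk.2).congr' ?_
      filter_upwards [hF] with ν hν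
      exact (hadd ν hν).symm
    | smul r g _ hg =>
      refine ⟨by simpa using hg.1.const_smul r, ?_⟩
      simpa [integral_const_mul] using hg.2.const_mul r
  have hAsep : A.SeparatesPoints := by
    intro x y hxy
    obtain ⟨U, hU, hxyU⟩ := hsep x y hxy
    let g : C(X, ℝ) := ⟨U.indicator 1,
      continuous_one.indicator (by simp [(hclopen U hU).frontier_eq])⟩
    refine ⟨g, ⟨g, Algebra.subset_adjoin ⟨U, hU, rfl⟩, rfl⟩, fun h => hxyU ?_⟩
    by_cases hx : x ∈ U <;> by_cases hy : y ∈ U <;> simp_all [g]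
  have happrox : ∀ δ > 0, ∃ g ∈ A, ‖g - f‖ < δ := fun δ hδ => by
    obtain ⟨g, hg⟩ :=
      ContinuousMap.exists_mem_subalgebra_near_continuousMap_of_separatesPoints A hAsep f δ hδ
    exact ⟨g, g.2, hg⟩
  have hfm : Measurable f := by
    choose g hgA hg using fun n : ℕ => happrox (1 / ((n : ℝ) + 1)) (by positivity)
    have hgf : Tendsto g atTop (𝓝 f) := by
      rw [tendsto_iff_norm_sub_tendsto_zero]
      exact squeeze_zero (fun _ => norm_nonneg _) (fun n => (hg n).le)
        tendsto_one_div_add_atTop_nhds_zero_nat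
    exact measurable_of_tendsto_metrizable (fun n => (hA _ (hgA n)).1)
      (tendsto_pi_nhds.2 fun x => ((continuous_eval_const x).tendsto f).comp hgf)
  refine ⟨hfm, tendsto_integral_of_forall_exists_approx hF (hint f hfm) fun δ hδ => ?_⟩
  obtain ⟨g, hgA, hg⟩ := happrox δ hδ
  refine ⟨g, hint g (hA g hgA).1, fun x => ?_, (hA g hgA).2⟩
  rw [norm_sub_rev]
  exact ((g - f).norm_coe_le_norm x).trans hg.le

theorem ScottOpen.univ {H : Type*} : ScottOpen (Set.univ : Set (Set H)) :=
  ⟨fun _ _ _ _ => mem_univ _, fun _ hne _ _ => by simpa using hne⟩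

theorem ScottOpen.inter {H : Type*} {U V : Set (Set H)} (hU : ScottOpen U) (hV : ScottOpen V) :
    ScottOpen (U ∩ V) := by
  refine ⟨fun a b hab h => ⟨hU.1 hab h.1, hV.1 hab h.2⟩, fun D hne hD h => ?_⟩
  obtain ⟨a, haD, haU⟩ := hU.2 D hne hD h.1
  obtain ⟨b, hbD, hbV⟩ := hV.2 D hne hD h.2
  obtain ⟨c, hcD, hac, hbc⟩ := hD a haD b hbD
  exact ⟨c, hcD, hU.1 hac haU, hV.1 hbc hbV⟩

theorem scottOpen_setOf_mem {H : Type*} (h : H) : ScottOpen {c : Set H | h ∈ c} :=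
  ⟨fun _ _ hab ha => hab ha, fun _ _ _ ⟨a, haD, ha⟩ => ⟨a, haD, ha⟩⟩

theorem compactSpace_cantorTop (H : Type*) : @CompactSpace (Set H) (cantorTop H) := by
  let := cantorTop H
  have hcont : Continuous fun (b : H → Bool) => {h | b h = true} := by
    refine continuous_generateFrom_iff.2 ?_
    rintro U (⟨h, rfl⟩ | ⟨h, rfl⟩)
    · exact (isOpen_discrete {true}).preimage (continuous_apply (A := fun _ : H => Bool) h)
    · exact (isOpen_discrete {b : Bool | ¬b = true}).preimage
        (continuous_apply (A := fun _ : H => Bool) h)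
  have hsurj : Function.Surjective fun (b : H → Bool) => {h | b h = true} := fun c => by
    classical exact ⟨fun h => decide (h ∈ c), by simp⟩
  exact hsurj.compactSpace hcont

theorem isClopen_cantorTop_setOf_mem {H : Type*} (h : H) :
    @IsClopen (Set H) (cantorTop H) {c | h ∈ c} := by
  let := cantorTop H
  exact ⟨⟨TopologicalSpace.isOpen_generateFrom_of_mem (Or.inr ⟨h, rfl⟩)⟩,
    TopologicalSpace.isOpen_generateFrom_of_mem (Or.inl ⟨h, rfl⟩)⟩

/-- For a nonempty `⊑`-directed family `D` of probability measures with `⊑`-supremum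
`μ*`, and a Cantor-continuous `f : Set H → ℝ` with values in `[0,1]`, the integrals of
`f` converge along `D` to the integral against `μ*`. -/
theorem integral_tendsto_of_directed {H : Type*} [Countable H]
    (D : Set (@Measure (Set H) (scottBorel H)))
    (μstar : @Measure (Set H) (scottBorel H))
    (hne : D.Nonempty)
    (hprob : ∀ μ ∈ D, @IsProbabilityMeasure (Set H) (scottBorel H) μ)
    (hdir : DirectedOn MeasLE D)
    (hstar : @IsProbabilityMeasure (Set H) (scottBorel H) μstar)
    (hsup : ∀ U : Set (Set H), ScottOpen U → μstar U = ⨆ μ ∈ D, μ U)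
    (f : Set H → ℝ)
    (hf : @Continuous (Set H) ℝ (cantorTop H) _ f)
    (hf01 : ∀ a : Set H, f a ∈ Set.Icc (0 : ℝ) 1) :
    ∀ ε : ℝ, 0 < ε → ∃ μ ∈ D, ∀ ν ∈ D, MeasLE μ ν →
      |MeasureTheory.integral ν f - MeasureTheory.integral μstar f| < ε := by
  let := cantorTop H
  let := scottBorel H
  have := compactSpace_cantorTop H
  let F : Filter (Measure (Set H)) := ⨅ μ ∈ D, 𝓟 {ν | ν ∈ D ∧ MeasLE μ ν}
  have hbasis : F.HasBasis (· ∈ D) fun μ => {ν | ν ∈ D ∧ MeasLE μ ν} := by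
    refine hasBasis_biInf_principal (fun μ hμ ν hν => ?_) hne
    obtain ⟨ρ, hρ, hμρ, hνρ⟩ := hdir μ hμ ν hν
    exact ⟨ρ, hρ, fun τ hτ => ⟨hτ.1, fun U hU => (hμρ U hU).trans (hτ.2 U hU)⟩,
      fun τ hτ => ⟨hτ.1, fun U hU => (hνρ U hU).trans (hτ.2 U hU)⟩⟩
  have hFD : ∀ᶠ ν in F, ν ∈ D :=
    hne.elim fun μ hμ => hbasis.eventually_iff.2 ⟨μ, hμ, fun _ hν => hν.1⟩
  have hlim : ∀ U, ScottOpen U → Tendsto (fun ν : Measure (Set H) => ν U) F (𝓝 (μstar U)) := by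
    intro U hU
    refine tendsto_order.2 ⟨fun a ha => ?_, fun a ha => ?_⟩
    · rw [hsup U hU] at ha
      simp only [lt_iSup_iff] at ha
      obtain ⟨μ, hμ, haμ⟩ := ha
      exact hbasis.eventually_iff.2 ⟨μ, hμ, fun ν hν => haμ.trans_le (hν.2 U hU)⟩
    · filter_upwards [hFD] with ν hν
      refine lt_of_le_of_lt ?_ ha
      rw [hsup U hU]
      exact le_iSup₂ (f := fun (μ : Measure (Set H)) (_ : μ ∈ D) => μ U) ν hν
  have hconv := (measurable_and_tendsto_integral_of_separating (μ₀ := μstar)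
    (hFD.mono hprob) (S := {U | ScottOpen U ∧ IsClopen U}) (fun U hU => hU.2)
    (fun U hU => MeasurableSpace.measurableSet_generateFrom hU.1)
    ⟨ScottOpen.univ, isClopen_univ⟩ (fun U hU V hV => ⟨hU.1.inter hV.1, hU.2.inter hV.2⟩)
    (fun x y hxy => by
      by_contra! hall
      exact hxy (Set.ext fun h =>
        hall _ ⟨scottOpen_setOf_mem h, isClopen_cantorTop_setOf_mem h⟩))
    (fun U hU => hlim U hU.1) ⟨f, hf⟩).2
  intro ε hε
  obtain ⟨μ, hμ, hν⟩ := hbasis.eventually_iff.1 (Metric.tendsto_nhds.1 hconv ε hε)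
  exact ⟨μ, hμ, fun ν hνD hμν => hν ⟨hνD, hμν⟩⟩
end
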